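/- Let b : [0,T] × T^d → R^d be a Borel vector field with ∫_0^T ∫_{T^d} |b(s,x)| dx ds < ∞. Let (η_n)_{n∈N} be Borel probability measures on Γ_T converging narrowly to η in P(Γ_T), such that for every n and every s ∈ [0,T] one has (e_s)_#η_n = L^d, and such that each η_n is concentrated on integral curves of b. Then (e_s)_#η = L^d for every s ∈ [0,T], and η is concentrated on integral curves of b. -/

import Mathlib

open MeasureTheory Set Filter Topology
open scoped ENNReal

noncomputable section

/-- The `d`-dimensional flat torus `ℝ^d/ℤ^d`. -/
abbrev Torus (d : ℕ) : Type := Fin d → AddCircle (1 : ℝ)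

/-- Values of vector fields: `ℝ^d` with the Euclidean norm. -/
abbrev Vec (d : ℕ) : Type := EuclideanSpace ℝ (Fin d)

/-- The canonical projection `ℝ^d → 𝕋^d`. -/
def projT (d : ℕ) (x : Vec d) : Torus d := fun i => (x i : AddCircle (1 : ℝ))

/-- The path space `Γ_T = C([0,T]; 𝕋^d)` with the supremum metric. -/
abbrev PathSpace (T : ℝ) (d : ℕ) : Type := C(Set.Icc (0 : ℝ) T, Torus d)

instance (T : ℝ) (d : ℕ) : MeasurableSpace (PathSpace T d) := borel _
instance (T : ℝ) (d : ℕ) : BorelSpace (PathSpace T d) := ⟨rfl⟩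

/-- Extension of a path `γ : [0,T] → 𝕋^d` to all of `ℝ` by projection onto `[0,T]`. -/
def extendPath {T : ℝ} {d : ℕ} (hT : 0 ≤ T) (γ : PathSpace T d) : ℝ → Torus d :=
  fun s => γ (Set.projIcc 0 T hT s)

/-- `γ` is an integral curve of `b`:  `s ↦ b(s,γ(s))` is integrable on `(0,T)` and
`γ(t) = γ(0) + ∫_0^t b(s,γ(s)) ds` for all `t ∈ [0,T]`, the integral computed in `ℝ^d`
and projected to the torus. -/
def IsIntegralCurveOf {T : ℝ} {d : ℕ} (hT : 0 ≤ T) (b : ℝ → Torus d → Vec d)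
    (γ : PathSpace T d) : Prop :=
  MeasureTheory.IntegrableOn (fun s => b s (extendPath hT γ s)) (Set.Ioc 0 T) volume ∧
  ∀ t : Set.Icc (0 : ℝ) T,
    γ t = γ ⟨0, Set.left_mem_Icc.2 hT⟩
      + projT d (∫ s in Set.Ioc (0 : ℝ) (t : ℝ), b s (extendPath hT γ s))

/-- `η` is concentrated on integral curves of `b`. -/
def ConcentratedOnCurves {T : ℝ} {d : ℕ} (hT : 0 ≤ T) (b : ℝ → Torus d → Vec d)
    (η : Measure (PathSpace T d)) : Prop :=
  ∀ᵐ γ ∂η, IsIntegralCurveOf hT b γ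

/-- `{k y}_{y}` is a disintegration of `μ` with respect to `f` and `ν`:
a Borel family of measures, with `k y` concentrated on `f⁻¹(y)` and
`μ(A) = ∫ k y (A) dν(y)` for every Borel set `A`. -/
def IsDisintegration {X Y : Type*} [MeasurableSpace X] [MeasurableSpace Y]
    (μ : Measure X) (f : X → Y) (ν : Measure Y) (k : Y → Measure X) : Prop :=
  (∀ A : Set X, MeasurableSet A → Measurable fun y => k y A) ∧
  (∀ y : Y, k y ((f ⁻¹' {y})ᶜ) = 0) ∧
  (∀ A : Set X, MeasurableSet A → μ A = ∫⁻ y, k y A ∂ν)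

/-- A disintegration consisting of probability measures. -/
def IsProbDisintegration {X Y : Type*} [MeasurableSpace X] [MeasurableSpace Y]
    (μ : Measure X) (f : X → Y) (ν : Measure Y) (k : Y → Measure X) : Prop :=
  (∀ y : Y, IsProbabilityMeasure (k y)) ∧ IsDisintegration μ f ν k


lemma norm_projT_le {d : ℕ} (v : Vec d) : ‖projT d v‖ ≤ ‖v‖ := by
  refine (pi_norm_le_iff_of_nonneg (norm_nonneg _)).2 fun i => ?_
  have h1 : ‖((v i : ℝ) : AddCircle (1 : ℝ))‖ ≤ ‖v i‖ := by
    rw [UnitAddCircle.norm_eq, Real.norm_eq_abs]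
    simpa using round_le (v i) 0
  exact h1.trans (PiLp.norm_apply_le v i)

lemma projT_sub {d : ℕ} (v w : Vec d) : projT d (v - w) = projT d v - projT d w := by
  funext i
  simp [projT]

lemma continuous_projT {d : ℕ} : Continuous (projT d) := by
  refine continuous_pi fun i => ?_
  exact (AddCircle.continuous_mk' (1 : ℝ)).comp (by fun_prop)

lemma continuous_extendPath_uncurry {T : ℝ} {d : ℕ} (hT : 0 ≤ T) :
    Continuous fun p : PathSpace T d × ℝ => extendPath hT p.1 p.2 := by
  unfold extendPath
  have : Continuous (Set.projIcc (0 : ℝ) T hT) := continuous_projIcc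
  fun_prop

lemma continuous_extendPath {T : ℝ} {d : ℕ} (hT : 0 ≤ T) (γ : PathSpace T d) :
    Continuous (extendPath hT γ) :=
  (continuous_extendPath_uncurry hT).comp (by fun_prop : Continuous fun s : ℝ => (γ, s))

/-- The defect of `γ` from being an integral curve, at time `t`. -/
def defect {T : ℝ} {d : ℕ} (hT : 0 ≤ T) (b : ℝ → Torus d → Vec d) (t : Set.Icc (0 : ℝ) T)
    (γ : PathSpace T d) : Torus d :=
  γ t - γ ⟨0, Set.left_mem_Icc.2 hT⟩
    - projT d (∫ s in Set.Ioc (0 : ℝ) (t : ℝ), b s (extendPath hT γ s))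

lemma defect_le {T : ℝ} {d : ℕ} (hT : 0 ≤ T) (b c : ℝ → Torus d → Vec d)
    (t : Set.Icc (0 : ℝ) T) (γ : PathSpace T d)
    (hb : IntegrableOn (fun s => b s (extendPath hT γ s)) (Set.Ioc 0 T) volume)
    (hc : IntegrableOn (fun s => c s (extendPath hT γ s)) (Set.Ioc 0 T) volume) :
    ‖defect hT c t γ‖ₑ ≤ ‖defect hT b t γ‖ₑ +
      ∫⁻ s in Set.Ioc 0 T, ‖b s (extendPath hT γ s) - c s (extendPath hT γ s)‖ₑ := by
  have hsub : Set.Ioc (0 : ℝ) t ⊆ Set.Ioc 0 T := Set.Ioc_subset_Ioc_right t.2.2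
  have h1 : defect hT c t γ = defect hT b t γ + projT d (∫ s in Set.Ioc (0 : ℝ) (t : ℝ),
      (b s (extendPath hT γ s) - c s (extendPath hT γ s))) := by
    rw [integral_sub (hb.mono_set hsub) (hc.mono_set hsub), projT_sub]
    unfold defect
    abel
  rw [h1]
  refine (enorm_add_le _ _).trans ?_
  gcongr
  calc _ ≤ ‖∫ s in Set.Ioc (0 : ℝ) (t : ℝ),
      (b s (extendPath hT γ s) - c s (extendPath hT γ s))‖ₑ :=
        enorm_le_iff_norm_le.2 (norm_projT_le _)
    _ ≤ ∫⁻ s in Set.Ioc (0 : ℝ) (t : ℝ), ‖b s (extendPath hT γ s) - c s (extendPath hT γ s)‖ₑ :=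
        enorm_integral_le_lintegral_enorm _
    _ ≤ _ := lintegral_mono_set hsub

lemma measurable_comp_path {T : ℝ} {d : ℕ} (hT : 0 ≤ T) {E : Type*} [MeasurableSpace E]
    {g : ℝ → Torus d → E} (hg : Measurable (Function.uncurry g)) :
    Measurable fun p : PathSpace T d × ℝ => g p.2 (extendPath hT p.1 p.2) :=
  hg.comp (measurable_snd.prodMk (continuous_extendPath_uncurry hT).measurable)

lemma measurable_defect {T : ℝ} {d : ℕ} (hT : 0 ≤ T) {b : ℝ → Torus d → Vec d}
    (hb : Measurable (Function.uncurry b)) (t : Set.Icc (0 : ℝ) T) :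
    Measurable (defect hT b t) := by
  have h1 : ∀ s : Set.Icc (0 : ℝ) T, Measurable fun γ : PathSpace T d => γ s := fun s =>
    (ContinuousEvalConst.continuous_eval_const s).measurable
  have h2 : Measurable fun γ : PathSpace T d =>
      ∫ s in Set.Ioc (0 : ℝ) (t : ℝ), b s (extendPath hT γ s) :=
    (measurable_comp_path hT hb).stronglyMeasurable.integral_prod_right'.measurable
  exact ((h1 _).sub (h1 _)).sub (continuous_projT.measurable.comp h2)

lemma continuous_defect {T : ℝ} {d : ℕ} (hT : 0 ≤ T)
    (g : BoundedContinuousFunction (ℝ × Torus d) (Vec d)) (t : Set.Icc (0 : ℝ) T) :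
    Continuous (defect hT (fun s x => g (s, x)) t) := by
  have h1 : ∀ s : Set.Icc (0 : ℝ) T, Continuous fun γ : PathSpace T d => γ s := fun s =>
    ContinuousEvalConst.continuous_eval_const s
  have h2 : Continuous fun γ : PathSpace T d =>
      ∫ s in Set.Ioc (0 : ℝ) (t : ℝ), g (s, extendPath hT γ s) := by
    refine continuous_of_dominated (bound := fun _ => ‖g‖) ?_ ?_ ?_ ?_
    · intro γ
      exact (g.continuous.comp
        (continuous_id.prodMk (continuous_extendPath hT γ))).aestronglyMeasurable
    · intro γ
      exact Eventually.of_forall fun s => g.norm_coe_le_norm _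
    · exact integrable_const _
    · refine Eventually.of_forall fun s => ?_
      exact g.continuous.comp (continuous_const.prodMk (h1 _))
  exact ((h1 _).sub (h1 _)).sub (continuous_projT.comp h2)

lemma integrableOn_bcf {T : ℝ} {d : ℕ} (hT : 0 ≤ T)
    (g : BoundedContinuousFunction (ℝ × Torus d) (Vec d)) (γ : PathSpace T d) :
    IntegrableOn (fun s => g (s, extendPath hT γ s)) (Set.Ioc 0 T) volume := by
  refine Integrable.of_bound (C := ‖g‖) ?_ (Eventually.of_forall fun s => g.norm_coe_le_norm _)
  exact (g.continuous.comp
        (continuous_id.prodMk (continuous_extendPath hT γ))).aestronglyMeasurable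

/-- Fubini plus incompressibility. -/
lemma lintegral_path {T : ℝ} {d : ℕ} (hT : 0 ≤ T) {g : ℝ → Torus d → ℝ≥0∞}
    (hg : Measurable (Function.uncurry g)) (η : Measure (PathSpace T d)) [IsProbabilityMeasure η]
    (hinc : ∀ s : Set.Icc (0 : ℝ) T,
      Measure.map (fun γ : PathSpace T d => γ s) η = (volume : Measure (Torus d))) :
    ∫⁻ γ, (∫⁻ s in Set.Ioc 0 T, g s (extendPath hT γ s)) ∂η =
      ∫⁻ s in Set.Ioc 0 T, ∫⁻ x, g s x := by
  rw [lintegral_lintegral_swap (measurable_comp_path hT hg).aemeasurable]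
  refine lintegral_congr fun s => ?_
  have hgs : Measurable (g s) := hg.comp measurable_prodMk_left
  rw [← hinc (Set.projIcc 0 T hT s), lintegral_map hgs
    (ContinuousEvalConst.continuous_eval_const _).measurable]
  rfl

/-- narrow limits of incompressible measures concentrated on integral
curves of `b` are incompressible and concentrated on integral curves of `b`. -/
theorem stmt_2 (T : ℝ) (hT : 0 < T) (d : ℕ) (b : ℝ → Torus d → Vec d)
    (hb : Measurable (Function.uncurry b))
    (hbL1 : ∫⁻ s in Set.Ioo 0 T, ∫⁻ x, (‖b s x‖₊ : ℝ≥0∞) ∂(volume : Measure (Torus d)) < ∞)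
    (ηseq : ℕ → Measure (PathSpace T d)) (hprob : ∀ n, IsProbabilityMeasure (ηseq n))
    (η : Measure (PathSpace T d)) [IsProbabilityMeasure η]
    (hconv : ∀ Φ : BoundedContinuousFunction (PathSpace T d) ℝ,
      Tendsto (fun n => ∫ γ, Φ γ ∂(ηseq n)) atTop (𝓝 (∫ γ, Φ γ ∂η)))
    (hinc : ∀ n, ∀ s : Set.Icc (0 : ℝ) T,
      Measure.map (fun γ : PathSpace T d => γ s) (ηseq n) = (volume : Measure (Torus d)))
    (hcurves : ∀ n, ConcentratedOnCurves hT.le b (ηseq n)) :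
    (∀ s : Set.Icc (0 : ℝ) T,
      Measure.map (fun γ : PathSpace T d => γ s) η = (volume : Measure (Torus d))) ∧
    ConcentratedOnCurves hT.le b η := by
  have hT' := hT.le
  have hmeas : ∀ s : Set.Icc (0 : ℝ) T, Measurable fun γ : PathSpace T d => γ s := fun s =>
    (ContinuousEvalConst.continuous_eval_const s).measurable
  have hinc' : ∀ s : Set.Icc (0 : ℝ) T,
      Measure.map (fun γ : PathSpace T d => γ s) η = (volume : Measure (Torus d)) := by
    intro s
    haveI : IsProbabilityMeasure (Measure.map (fun γ : PathSpace T d => γ s) η) :=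
      Measure.isProbabilityMeasure_map (hmeas s).aemeasurable
    refine ext_of_forall_integral_eq_of_IsFiniteMeasure fun f => ?_
    have h1 := hconv (f.compContinuous ⟨fun γ : PathSpace T d => γ s,
      ContinuousEvalConst.continuous_eval_const s⟩)
    have h2 : ∀ n, ∫ γ : PathSpace T d, f (γ s) ∂(ηseq n) = ∫ x, f x := by
      intro n
      rw [← hinc n s, integral_map (hmeas s).aemeasurable f.continuous.aestronglyMeasurable]
    rw [integral_map (hmeas s).aemeasurable f.continuous.aestronglyMeasurable]
    refine tendsto_nhds_unique h1 ?_
    exact tendsto_const_nhds.congr fun n => (h2 n).symm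
  refine ⟨hinc', ?_⟩
  have hbL1' : ∫⁻ s in Set.Ioc 0 T, ∫⁻ x, ‖b s x‖ₑ ∂(volume : Measure (Torus d)) < ∞ := by
    rw [← Measure.restrict_congr_set (Ioo_ae_eq_Ioc (μ := volume) (a := (0 : ℝ)) (b := T))]
    exact hbL1
  -- a.e. integrability along curves
  have hint : ∀ᵐ γ ∂η,
      IntegrableOn (fun s => b s (extendPath hT' γ s)) (Set.Ioc 0 T) volume := by
    have h1 := lintegral_path hT' (g := fun s x => ‖b s x‖ₑ) hb.enorm η hinc'
    have hm : Measurable fun γ : PathSpace T d =>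
        ∫⁻ s in Set.Ioc 0 T, ‖b s (extendPath hT' γ s)‖ₑ :=
      (measurable_comp_path hT' (g := fun s x => ‖b s x‖ₑ) hb.enorm).lintegral_prod_right'
    have h2 := ae_lt_top hm (by rw [h1]; exact hbL1'.ne)
    filter_upwards [h2] with γ hγ
    refine ⟨?_, hγ⟩
    exact (hb.comp (measurable_id.prodMk
      (continuous_extendPath hT' γ).measurable)).aestronglyMeasurable
  set μ : Measure (ℝ × Torus d) := (volume.restrict (Set.Ioc 0 T)).prod volume with hμ
  have hbint : Integrable (Function.uncurry b) μ := by
    refine ⟨hb.aestronglyMeasurable, ?_⟩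
    rw [HasFiniteIntegral, hμ, lintegral_prod _ hb.enorm.aemeasurable]
    exact hbL1'
  have key : ∀ t : Set.Icc (0 : ℝ) T, ∀ᵐ γ ∂η, defect hT' b t γ = 0 := by
    intro t
    have hz : ∫⁻ γ, ‖defect hT' b t γ‖ₑ ∂η = 0 := by
      have hle : ∀ ε : ℝ≥0∞, ε ≠ 0 → ∫⁻ γ, ‖defect hT' b t γ‖ₑ ∂η ≤ ε + ε := by
        intro ε hε
        obtain ⟨g, hg, -⟩ := hbint.exists_boundedContinuous_lintegral_sub_le hε
        have hgm : Measurable (Function.uncurry fun s x => ‖b s x - g (s, x)‖ₑ) :=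
          (hb.sub g.continuous.measurable).enorm
        have hg' : ∫⁻ s in Set.Ioc 0 T, ∫⁻ x, ‖b s x - g (s, x)‖ₑ ≤ ε := by
          refine le_trans (le_of_eq ?_) hg
          exact (lintegral_prod (μ := volume.restrict (Set.Ioc (0 : ℝ) T)) (ν := volume) _
            hgm.aemeasurable).symm
        -- the continuous defect
        have hcn : ∀ n, ∫⁻ γ, ‖defect hT' (fun s x => g (s, x)) t γ‖ₑ ∂(ηseq n) ≤ ε := by
          intro n
          haveI := hprob n
          refine le_trans ?_ hg'
          rw [← lintegral_path hT' hgm (ηseq n) (hinc n)]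
          refine lintegral_mono_ae ?_
          filter_upwards [hcurves n] with γ hγ
          refine (defect_le hT' b _ t γ hγ.1 (integrableOn_bcf hT' g γ)).trans ?_
          have : defect hT' b t γ = 0 := by
            unfold defect
            rw [hγ.2 t]
            abel
          rw [this]
          simp
        let N : BoundedContinuousFunction (Torus d) ℝ :=
          BoundedContinuousFunction.mkOfCompact ⟨fun x => ‖x‖, continuous_norm⟩
        let Φ : BoundedContinuousFunction (PathSpace T d) ℝ :=
          N.compContinuous ⟨_, continuous_defect hT' g t⟩
        have hΦ : ∀ γ, Φ γ = ‖defect hT' (fun s x => g (s, x)) t γ‖ := fun γ => rfl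
        have hΦi : ∀ ν : Measure (PathSpace T d), IsProbabilityMeasure ν →
            ENNReal.ofReal (∫ γ, Φ γ ∂ν) =
              ∫⁻ γ, ‖defect hT' (fun s x => g (s, x)) t γ‖ₑ ∂ν := by
          intro ν hν
          rw [ofReal_integral_eq_lintegral_ofReal (Φ.integrable ν)
            (Eventually.of_forall fun γ => by rw [hΦ]; exact norm_nonneg _)]
          refine lintegral_congr fun γ => ?_
          rw [hΦ, ofReal_norm]
        have hc : ∫⁻ γ, ‖defect hT' (fun s x => g (s, x)) t γ‖ₑ ∂η ≤ ε := by
          rw [← hΦi η inferInstance]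
          refine le_of_tendsto' (ENNReal.tendsto_ofReal (hconv Φ)) fun n => ?_
          rw [hΦi _ (hprob n)]
          exact hcn n
        calc ∫⁻ γ, ‖defect hT' b t γ‖ₑ ∂η
            ≤ ∫⁻ γ, (‖defect hT' (fun s x => g (s, x)) t γ‖ₑ +
              ∫⁻ s in Set.Ioc 0 T, ‖b s (extendPath hT' γ s) - g (s, extendPath hT' γ s)‖ₑ) ∂η := by
              refine lintegral_mono_ae ?_
              filter_upwards [hint] with γ hγ
              refine (defect_le hT' (fun s x => g (s, x)) b t γ
                (integrableOn_bcf hT' g γ) hγ).trans (le_of_eq ?_)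
              congr 1
              refine lintegral_congr fun s => ?_
              rw [enorm_sub_rev]
          _ = ∫⁻ γ, ‖defect hT' (fun s x => g (s, x)) t γ‖ₑ ∂η +
              ∫⁻ γ, (∫⁻ s in Set.Ioc 0 T,
                ‖b s (extendPath hT' γ s) - g (s, extendPath hT' γ s)‖ₑ) ∂η :=
              lintegral_add_left (continuous_defect hT' g t).measurable.enorm _
          _ ≤ ε + ε := by
              gcongr
              exact (lintegral_path hT' hgm η hinc').trans_le hg'
      by_contra hne
      obtain ⟨ε, hε0, hε⟩ := ENNReal.exists_pos_sum_of_countable hne Bool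
      have h3 := hle (min (ε true) (ε false) : NNReal) (by
        have := lt_min (hε0 true) (hε0 false)
        exact_mod_cast this.ne')
      refine absurd (h3.trans ?_) (not_le.2 hε)
      rw [tsum_bool]
      gcongr
      · exact min_le_right _ _
      · exact min_le_left _ _
    rw [lintegral_eq_zero_iff (measurable_defect hT' hb t).enorm] at hz
    filter_upwards [hz] with γ hγ
    simpa using hγ
  obtain ⟨D, hDc, hDd⟩ := TopologicalSpace.exists_countable_dense (Set.Icc (0 : ℝ) T)
  have hall : ∀ᵐ γ ∂η, ∀ t ∈ D, defect hT' b t γ = 0 := (ae_ball_iff hDc).2 fun t _ => key t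
  filter_upwards [hint, hall] with γ h1 h2
  refine ⟨h1, fun t => ?_⟩
  have hcont : Continuous fun t : Set.Icc (0 : ℝ) T =>
      ∫ s in Set.Ioc (0 : ℝ) (t : ℝ), b s (extendPath hT' γ s) :=
    continuousOn_iff_continuous_domRestrict.1
      (intervalIntegral.continuousOn_primitive ((integrableOn_Icc_iff_integrableOn_Ioc (by simp)).2 h1))
  have heq := Continuous.ext_on hDd γ.continuous
    (continuous_const.add (continuous_projT.comp hcont) :
      Continuous fun t : Set.Icc (0 : ℝ) T => γ ⟨0, Set.left_mem_Icc.2 hT'⟩ +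
        projT d (∫ s in Set.Ioc (0 : ℝ) (t : ℝ), b s (extendPath hT' γ s)))
    (fun t ht => by
      have := h2 t ht
      unfold defect at this
      rw [sub_eq_zero, sub_eq_iff_eq_add'] at this
      exact this)
  exact congrFun heq t
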